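/- Let (f_n) satisfy the standard conditions, let m ≥ 1, and let X ⊆ ℝ be a compact m-(f_n)-microscopic set. Then X can be written as a union of m sets A_0, …, A_{m-1}, each of which is (f_n)-microscopic. -/

import Mathlib

open Set MeasureTheory

/-- `M` can be covered by a sequence of intervals whose `k`-th length is at most `len k`. -/
def IntervalCover (M : Set ℝ) (len : ℕ → ℝ) : Prop :=
  ∃ a b : ℕ → ℝ, M ⊆ ⋃ k, Set.Icc (a k) (b k) ∧ ∀ k, b k - a k ≤ len k

def Microscopic (M : Set ℝ) : Prop :=
  ∀ ε : ℝ, 0 < ε → ε < 1 → IntervalCover M (fun k => ε ^ k)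

def Nanoscopic (M : Set ℝ) : Prop :=
  ∀ ε : ℝ, 0 < ε → ε < 1 → IntervalCover M (fun k => ε ^ (2 ^ k))

def Picoscopic (M : Set ℝ) : Prop :=
  ∀ ε : ℝ, 0 < ε → ε < 1 → IntervalCover M (fun k => ε ^ (Nat.factorial (k + 1)))

def FnMicroscopic (f : ℕ → ℝ → ℝ) (M : Set ℝ) : Prop :=
  ∀ ε : ℝ, 0 < ε → ε < 1 → IntervalCover M (fun k => f k ε)

/-- The standard conditions on a sequence of functions generating generalized microscopic sets. -/
def StandardConditions (f : ℕ → ℝ → ℝ) : Prop :=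
  (∀ n, ∀ x ∈ Set.Ioo (0:ℝ) 1, f n x ∈ Set.Ioo (0:ℝ) 1) ∧
  (∀ n, StrictMonoOn (f n) (Set.Ioo (0:ℝ) 1)) ∧
  (∀ n, ∀ x ∈ Set.Ioo (0:ℝ) 1, f (n + 1) x ≤ f n x) ∧
  (∀ n, Filter.Tendsto (f n) (nhdsWithin 0 (Set.Ioi 0)) (nhds 0)) ∧
  (∃ x₀ : ℝ, 0 < x₀ ∧ ∀ x : ℝ, 0 < x → x < x₀ → Summable fun n => f n x)

def StrongMeasureZero (B : Set ℝ) : Prop :=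
  ∀ ε : ℕ → ℝ, (∀ k, 0 < ε k) → IntervalCover B ε

def IsFsigma (F : Set ℝ) : Prop :=
  ∃ C : ℕ → Set ℝ, (∀ n, IsClosed (C n)) ∧ F = ⋃ n, C n

/-- `A` can be covered by an `Fσ` set which is `(f n)`-microscopic. -/
def MicroStar (f : ℕ → ℝ → ℝ) (A : Set ℝ) : Prop :=
  ∃ F : Set ℝ, IsFsigma F ∧ FnMicroscopic f F ∧ A ⊆ F

/-- `m`-`(f n)`-microscopic sets. -/
def MFnMicroscopic (f : ℕ → ℝ → ℝ) (m : ℕ) (M : Set ℝ) : Prop :=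
  ∀ ε : ℝ, 0 < ε → ε < 1 → ∃ a b : ℕ → ℝ, M ⊆ ⋃ k, Set.Icc (a k) (b k) ∧
    ∀ k : ℕ, ∀ j < m, b (m * k + j) - a (m * k + j) ≤ f k ε

def TwoNanoscopic (M : Set ℝ) : Prop :=
  MFnMicroscopic (fun k ε => ε ^ (2 ^ k)) 2 M


lemma aux_anti (f : ℕ → ℝ → ℝ) (hf : StandardConditions f) {x : ℝ} (hx : x ∈ Set.Ioo (0:ℝ) 1) :
    Antitone (fun n => f n x) :=
  antitone_nat_of_succ_le (fun n => hf.2.2.1 n x hx)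

lemma aux_shift (f : ℕ → ℝ → ℝ) (hf : StandardConditions f) (X : Set ℝ) (hXc : IsCompact X)
    (N : ℕ) (ε : ℝ) (hε : ε ∈ Set.Ioo (0:ℝ) 1) :
    ∃ ε' ∈ Set.Ioo (0:ℝ) 1, ∀ a b : ℕ → ℝ, (∀ k, b k - a k ≤ f k ε') →
      ∃ a' b' : ℕ → ℝ, (∀ x ∈ X, (∃ k, x ∈ Set.Icc (a k) (b k)) →
        ∃ k, N ≤ k ∧ x ∈ Set.Icc (a' k) (b' k)) ∧ ∀ k, N ≤ k → b' k - a' k ≤ f k ε := by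
  classical
  rcases X.eq_empty_or_nonempty with hX | ⟨s, hs⟩
  · refine ⟨ε, hε, fun a b _ => ⟨0, 0, ?_, ?_⟩⟩
    · intro x hx; simp [hX] at hx
    · intro k _; simpa using (hf.1 k ε hε).1.le
  set δ := f N ε with hδ
  have hδ0 : 0 < δ := (hf.1 N ε hε).1
  obtain ⟨T, -, hTf, hT⟩ := hXc.finite_cover_balls (show 0 < δ/4 by positivity)
  lift T to Finset ℝ using hTf
  set L := T.card * N + N + 1 with hL
  have hLpos : 0 < f L ε := (hf.1 L ε hε).1
  obtain ⟨ε', hε', hle, h0⟩ : ∃ ε' ∈ Set.Ioo (0:ℝ) 1, ε' ≤ ε ∧ f 0 ε' ≤ min (f L ε) (δ/4) := by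
    have h1 := (hf.2.2.2.1 0).eventually (gt_mem_nhds (show (0:ℝ) < min (f L ε) (δ/4) by positivity))
    have h2 : Set.Ioo (0:ℝ) ε ∈ nhdsWithin (0:ℝ) (Set.Ioi 0) := Ioo_mem_nhdsGT hε.1
    obtain ⟨e, he1, he2⟩ := (h1.and h2).exists
    exact ⟨e, ⟨he2.1, he2.2.trans hε.2⟩, he2.2.le, he1.le⟩
  refine ⟨ε', hε', fun a b hab => ?_⟩
  have hab0 : ∀ k, b k - a k ≤ f 0 ε' := fun k => (hab k).trans (aux_anti f hf hε' (Nat.zero_le k))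
  have hcell : ∀ k : ℕ, ∃ t ∈ T, ∀ x ∈ X, x ∈ Set.Icc (a k) (b k) →
      x ∈ Set.Icc (t - δ/2) (t + δ/2) := by
    intro k
    by_cases h : ∃ y ∈ X, y ∈ Set.Icc (a k) (b k)
    · obtain ⟨y, hy, hyI⟩ := h
      have := hT hy
      simp only [Set.mem_iUnion, Metric.mem_ball, Real.dist_eq, Finset.mem_coe] at this
      obtain ⟨t, ht, hyt⟩ := this
      refine ⟨t, ht, fun x hx hxI => ?_⟩
      have h3 := hab0 k
      have h4 := h0.trans (min_le_right _ _)
      rw [abs_lt] at hyt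
      constructor <;> linarith [hyI.1, hyI.2, hxI.1, hxI.2]
    · have := hT hs
      simp only [Set.mem_iUnion, Finset.mem_coe] at this
      obtain ⟨t, ht, _⟩ := this
      exact ⟨t, ht, fun x hx hxI => absurd ⟨x, hx, hxI⟩ h⟩
  choose c hcT hc using hcell
  obtain ⟨t, htT, htc⟩ := Finset.exists_lt_card_fiber_of_mul_lt_card_of_maps_to
    (s := Finset.range L) (t := T) (f := c) (n := N) (fun k _ => hcT k)
    (by rw [Finset.card_range]; omega)
  set R := (Finset.range L).filter (fun k => ¬ c k = t) with hR
  have hRc : R.card ≤ (Finset.Ioo N L).card := by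
    have := Finset.card_filter_add_card_filter_not (s := Finset.range L) (fun k => c k = t)
    rw [Finset.card_range] at this
    rw [Nat.card_Ioo]
    have h2 : R.card = L - ((Finset.range L).filter (fun k => c k = t)).card := by
      apply Nat.eq_sub_of_add_eq
      rw [add_comm]
      convert this using 2
    omega
  obtain ⟨e⟩ : Nonempty (R ↪ (Finset.Ioo N L : Finset ℕ)) :=
    Function.Embedding.nonempty_of_card_le (by simpa only [Fintype.card_coe] using hRc)
  have hg : ∃ g : ℕ → ℕ, ∀ r ∈ R, ∃ k, N < k ∧ k < L ∧ g k = r := by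
    refine ⟨fun k => if h : ∃ r : R, (e r : ℕ) = k then (h.choose : ℕ) else 0, fun r hr => ?_⟩
    have hm := Finset.mem_Ioo.1 (e ⟨r, hr⟩).2
    refine ⟨e ⟨r, hr⟩, hm.1, hm.2, ?_⟩
    have h : ∃ r' : R, (e r' : ℕ) = e ⟨r, hr⟩ := ⟨_, rfl⟩
    beta_reduce
    rw [dif_pos h]
    have := e.injective (Subtype.ext h.choose_spec)
    rw [this]
  obtain ⟨g, hg⟩ := hg
  refine ⟨fun k => if k = N then t - δ/2 else if k < L then a (g k) else a k,
    fun k => if k = N then t + δ/2 else if k < L then b (g k) else b k, ?_, ?_⟩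
  · rintro x hx ⟨k, hk⟩
    by_cases hkL : k < L
    · by_cases hct : c k = t
      · refine ⟨N, le_rfl, ?_⟩
        have := hc k x hx hk
        rw [hct] at this
        simpa using this
      · obtain ⟨k', h1, h2, h3⟩ := hg k (by simp [hR, hkL, hct])
        refine ⟨k', h1.le, ?_⟩
        simp only [h1.ne', h2, if_true, if_false, h3]
        exact hk
    · refine ⟨k, by omega, ?_⟩
      have : k ≠ N := by omega
      simp only [this, hkL, if_false]
      exact hk
  · intro k hk
    by_cases h1 : k = N
    · simp only [h1, if_true]; linarith
    · by_cases h2 : k < L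
      · simp only [h1, h2, if_true, if_false]
        exact (hab0 _).trans ((h0.trans (min_le_left _ _)).trans (aux_anti f hf hε h2.le))
      · simp only [h1, h2, if_false]
        exact (hab k).trans ((hf.2.1 k).monotoneOn hε' hε hle)

lemma aux_fin (f : ℕ → ℝ → ℝ) (hf : StandardConditions f)
    (m : ℕ) (hmpos : 1 ≤ m) (X : Set ℝ) (hXc : IsCompact X)
    (hX : MFnMicroscopic f m X) (ε : ℝ) (hε : ε ∈ Set.Ioo (0:ℝ) 1) (N : ℕ) :
    ∃ N' : ℕ, N ≤ N' ∧ ∃ a b : ℕ → ℕ → ℝ,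
      (∀ x ∈ X, ∃ j < m, ∃ k, N ≤ k ∧ k < N' ∧ x ∈ Set.Icc (a j k) (b j k)) ∧
      ∀ j < m, ∀ k, N ≤ k → b j k - a j k ≤ f k ε := by
  have hε2 : ε/2 ∈ Set.Ioo (0:ℝ) 1 := ⟨by linarith [hε.1], by linarith [hε.1, hε.2]⟩
  obtain ⟨ε', hε', H⟩ := aux_shift f hf X hXc N (ε/2) hε2
  obtain ⟨a, b, hcov, hlen⟩ := hX ε' hε'.1 hε'.2
  have H2 : ∀ j : ℕ, ∃ a' b' : ℕ → ℝ, j < m → (∀ x ∈ X, (∃ k, x ∈ Set.Icc (a (m*k+j)) (b (m*k+j))) →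
        ∃ k, N ≤ k ∧ x ∈ Set.Icc (a' k) (b' k)) ∧ ∀ k, N ≤ k → b' k - a' k ≤ f k (ε/2) := by
    intro j
    by_cases hj : j < m
    · obtain ⟨a', b', h⟩ := H (fun k => a (m*k+j)) (fun k => b (m*k+j)) (fun k => hlen k j hj)
      exact ⟨a', b', fun _ => h⟩
    · exact ⟨0, 0, fun h => absurd h hj⟩
  choose a' b' h' using H2
  set η : ℕ → ℝ := fun k => (f k ε - f k (ε/2))/2 with hη
  have hηpos : ∀ k, 0 < η k := fun k => by
    have := hf.2.1 k hε2 hε (by linarith [hε.1])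
    simp only [hη]; linarith
  obtain ⟨F, hF⟩ := hXc.elim_finite_subcover
    (fun i : ℕ => ⋃ j ∈ {j | j < m}, Set.Ioo (a' j (N+i) - η (N+i)) (b' j (N+i) + η (N+i)))
    (fun i => isOpen_biUnion fun j _ => isOpen_Ioo)
    (by
      intro x hx
      obtain ⟨k, hk⟩ := Set.mem_iUnion.1 (hcov hx)
      · have hj := Nat.mod_lt k hmpos
        obtain ⟨k', hk', hx'⟩ := (h' (k % m) hj).1 x hx ⟨k / m, by rwa [Nat.div_add_mod]⟩
        obtain ⟨i, rfl⟩ := Nat.exists_eq_add_of_le hk'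
        simp only [Set.mem_iUnion]
        have := hηpos (N+i)
        exact ⟨i, k % m, hj, by linarith [hx'.1], by linarith [hx'.2]⟩)
  refine ⟨N + (F.sup id + 1), by omega, fun j k => a' j k - η k, fun j k => b' j k + η k, ?_, ?_⟩
  · intro x hx
    have := hF hx
    simp only [Set.mem_iUnion] at this
    obtain ⟨i, hi, j, hj, hxI⟩ := this
    have : i ≤ F.sup id := Finset.le_sup (f := id) hi
    exact ⟨j, hj, N+i, by omega, by omega, hxI.1.le, hxI.2.le⟩
  · intro j hj k hk
    have := (h' j hj).2 k hk
    simp only [hη]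
    linarith

theorem stmt13 (f : ℕ → ℝ → ℝ) (hf : StandardConditions f)
    (m : ℕ) (hm : 1 ≤ m) (X : Set ℝ) (hXc : IsCompact X)
    (hX : MFnMicroscopic f m X) :
    ∃ A : ℕ → Set ℝ, X = ⋃ j ∈ Finset.range m, A j ∧
      ∀ j < m, FnMicroscopic f (A j) := by
  classical
  have he : ∀ n : ℕ, (1:ℝ)/((n:ℝ)+2) ∈ Set.Ioo (0:ℝ) 1 := fun n => by
    have : (0:ℝ) ≤ n := Nat.cast_nonneg n
    refine ⟨by positivity, ?_⟩
    rw [div_lt_one (by positivity)]; linarith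
  choose N' hN' a b hcov hlen using fun n : ℕ => aux_fin f hf m hm X hXc hX _ (he n)
  let M : ℕ → ℕ := fun n => Nat.rec 0 (fun n p => N' n p) n
  have hM : ∀ n, M (n+1) = N' n (M n) := fun n => rfl
  have hMmono : Monotone M := monotone_nat_of_le_succ (fun n => by rw [hM]; exact hN' n _)
  refine ⟨fun j => {x | x ∈ X ∧ ∃ᶠ n in Filter.atTop, ∃ k, M n ≤ k ∧ k < M (n+1) ∧
    x ∈ Set.Icc (a n (M n) j k) (b n (M n) j k)}, ?_, ?_⟩
  · ext x
    simp only [Set.mem_iUnion, Set.mem_ofPred_eq, Finset.mem_range, exists_prop]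
    refine ⟨fun hx => ?_, fun ⟨j, _, hx, _⟩ => hx⟩
    by_contra hcon
    push Not at hcon
    have h1 : ∀ j ∈ Finset.range m, ∀ᶠ n in Filter.atTop, ¬ ∃ k, M n ≤ k ∧ k < M (n+1) ∧
        x ∈ Set.Icc (a n (M n) j k) (b n (M n) j k) := by
      intro j hj
      by_contra h
      have h2 : ∃ᶠ n in Filter.atTop, ∃ k, M n ≤ k ∧ k < M (n+1) ∧
        x ∈ Set.Icc (a n (M n) j k) (b n (M n) j k) := h
      have h3 := hcon j (Finset.mem_range.1 hj) hx
      first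
        | exact h3 h2
        | exact h (h3.mono fun n hn ⟨k, hk1, hk2, hk3⟩ => hn k hk1 hk2 hk3)
    obtain ⟨n, hn⟩ := ((Filter.eventually_all_finset _).2 h1).exists
    obtain ⟨j, hj, k, hk⟩ := hcov n (M n) x hx
    exact hn j (Finset.mem_range.2 hj) ⟨k, hk⟩
  · intro j hj ε hε0 hε1
    obtain ⟨n0, hn0⟩ := exists_nat_one_div_lt hε0
    have hn : ∀ n ≥ n0, (1:ℝ)/((n:ℝ)+2) ≤ ε := fun n hn => by
      have : (n0:ℝ) ≤ n := by exact_mod_cast hn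
      refine le_trans ?_ hn0.le
      apply one_div_le_one_div_of_le <;> [positivity; linarith]
    let P : ℕ → ℕ → Prop := fun k n => n0 ≤ n ∧ M n ≤ k ∧ k < M (n+1)
    have huniq : ∀ k n n', P k n → P k n' → n = n' := by
      intro k n n' h h'
      rcases lt_trichotomy n n' with hl | hl | hl
      · have := hMmono (Nat.succ_le_of_lt hl)
        have h1 := h.2.2
        have h2 := h'.2.1
        simp only [Nat.succ_eq_add_one] at this
        omega
      · exact hl
      · have := hMmono (Nat.succ_le_of_lt hl)
        have h1 := h'.2.2
        have h2 := h.2.1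
        simp only [Nat.succ_eq_add_one] at this
        omega
    have hν : ∃ ν : ℕ → ℕ, ∀ k n, P k n → ν k = n := by
      have h1 : ∀ k, ∃ v : ℕ, ∀ n, P k n → v = n := by
        intro k
        rcases Classical.em (∃ n, P k n) with h | h
        · obtain ⟨v, hv⟩ := h
          exact ⟨v, fun n hn => huniq k v n hv hn⟩
        · exact ⟨0, fun n hn => absurd ⟨n, hn⟩ h⟩
      choose ν hν using h1
      exact ⟨ν, hν⟩
    obtain ⟨ν, hν⟩ := hν
    have hI : ∀ k, ∃ p q : ℝ, q - p ≤ f k ε ∧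
        (P k (ν k) → p = a (ν k) (M (ν k)) j k ∧ q = b (ν k) (M (ν k)) j k) := by
      intro k
      rcases Classical.em (P k (ν k)) with h | h
      · exact ⟨_, _, (hlen _ _ j hj k h.2.1).trans
          ((hf.2.1 k).monotoneOn (he _) ⟨hε0, hε1⟩ (hn _ h.1)), fun _ => ⟨rfl, rfl⟩⟩
      · exact ⟨0, 0, by simpa using (hf.1 k ε ⟨hε0, hε1⟩).1.le, fun h' => absurd h' h⟩
    choose p q hpq hpq' using hI
    refine ⟨p, q, ?_, hpq⟩
    rintro x ⟨hx, hfr⟩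
    obtain ⟨n, hnn, k, hk1, hk2, hk3⟩ := Filter.frequently_atTop.1 hfr n0
    have hP : P k n := ⟨hnn, hk1, hk2⟩
    have hνn := hν k n hP
    have h3 := hpq' k (by rw [hνn]; exact hP)
    rw [hνn] at h3
    refine Set.mem_iUnion.2 ⟨k, ?_⟩
    rw [h3.1, h3.2]
    exact hk3
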